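/- (Jackson's summation for a terminating very-well-poised 8W7) Let n be a nonnegative integer and let q, a, b, c, d, e be complex numbers with q ≠ 0, q not a root of unity, a ≠ 1, b, c, d, e ≠ 0, satisfying the balance condition b c d e = a² q^{n+1}, and such that (q;q)_k, (aq/b;q)_k, (aq/c;q)_k, (aq/d;q)_k, (aq/e;q)_k, and (a q^{n+1};q)_k are nonzero for 0 ≤ k ≤ n. Then ∑_{k=0}^n [(1 - a q^{2k})/(1 - a)] · [(a;q)_k (b;q)_k (c;q)_k (d;q)_k (e;q)_k (q^{-n};q)_k / ((q;q)_k (aq/b;q)_k (aq/c;q)_k (aq/d;q)_k (aq/e;q)_k (a q^{n+1};q)_k)] q^k = (aq;q)_n (aq/(bc);q)_n (aq/(bd);q)_n (aq/(cd);q)_n / ((aq/b;q)_n (aq/c;q)_n (aq/d;q)_n (aq/(bcd);q)_n). -/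

import Mathlib

/-- The finite q-shifted factorial `(a;q)_k = ∏_{j=0}^{k-1} (1 - a q^j)`. -/
noncomputable def qPoch (a q : ℂ) (k : ℕ) : ℂ := ∏ j ∈ Finset.range k, (1 - a * q ^ j)

lemma qPoch_zero' (a q : ℂ) : qPoch a q 0 = 1 := by simp [qPoch]

lemma qPoch_succ' (a q : ℂ) (k : ℕ) : qPoch a q (k+1) = qPoch a q k * (1 - a * q ^ k) := by
  simp [qPoch, Finset.prod_range_succ]

lemma qPoch_succ_left (a q : ℂ) (k : ℕ) : qPoch a q (k+1) = (1 - a) * qPoch (a * q) q k := by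
  simp only [qPoch, Finset.prod_range_succ']
  rw [mul_comm]
  congr 1
  · simp
  · apply Finset.prod_congr rfl
    intro j _
    ring

lemma qPoch_ne {a q : ℂ} {k : ℕ} : qPoch a q k ≠ 0 ↔ ∀ j < k, a * q ^ j ≠ 1 := by
  simp only [qPoch, Finset.prod_ne_zero_iff, Finset.mem_range, sub_ne_zero]
  exact ⟨fun h j hj h' => h j hj h'.symm, fun h j hj h' => h j hj h'.symm⟩

/-- The summand, in symmetric form. -/
noncomputable def jT (q a b c d e f : ℂ) (k : ℕ) : ℂ :=
  (1 - a * q ^ (2 * k)) / (1 - a) *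
        (qPoch a q k * qPoch b q k * qPoch c q k * qPoch d q k * qPoch e q k *
            qPoch f q k /
          (qPoch q q k * qPoch (a * q / b) q k * qPoch (a * q / c) q k *
            qPoch (a * q / d) q k * qPoch (a * q / e) q k *
            qPoch (a * q / f) q k)) * q ^ k

lemma j_key (a b c d E f x : ℂ) (ha : a ≠ 0) (hb : b ≠ 0) (hc : c ≠ 0) (hd : d ≠ 0)
    (hf : f ≠ 0) (h : E = a ^ 2 / (b * c * d * f)) :
    (f - E) * ((1 - a * x) * (1 - b * x) * (1 - c * x) * (1 - d * x) * (1 - E * x) * (1 - f * x)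
      - (1 - x) * (1 - a / b * x) * (1 - a / c * x) * (1 - a / d * x) * (1 - a / E * x)
        * (1 - a / f * x))
    = x * (1 - a * x ^ 2) *
      (f * (1 - f) * ((1 - a / (b * f)) * (1 - a / (c * f)) * (1 - a / (d * f)))
          * ((1 - E * x) * (1 - a / E * x))
        - E * (1 - E) * ((1 - a / (b * E)) * (1 - a / (c * E)) * (1 - a / (d * E)))
          * ((1 - f * x) * (1 - a / f * x))) := by
  subst h
  field_simp
  ring

lemma j_key0 (a b c d E f : ℂ) (ha : a ≠ 0) (hb : b ≠ 0) (hc : c ≠ 0) (hd : d ≠ 0)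
    (hf : f ≠ 0) (h : E = a ^ 2 / (b * c * d * f)) :
    f * ((1 - a / (b * f)) * (1 - a / (c * f)) * (1 - a / (d * f))) * (1 - a / E)
      - E * ((1 - a / (b * E)) * (1 - a / (c * E)) * (1 - a / (d * E))) * (1 - a / f)
    = (f - E) * (1 - b) * (1 - c) * (1 - d) := by
  subst h
  field_simp
  ring

lemma j_alg1 (g w P X r s Y R Z V x u v : ℂ) (hu : u ≠ 0) (hv : v ≠ 0) :
    g / w * (P * (X * r) * (s * Y) / (R * Z * V)) * x
    = P * X * Y / (R * (Z * u) * (v * V)) * (g * x / w * (s * v) * (r * u)) := by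
  rw [show R * (Z * u) * (v * V) = (R * Z * V) * (u * v) by ring,
    show P * X * Y / (R * Z * V * (u * v)) * (g * x / w * (s * v) * (r * u))
      = P * X * Y / (R * Z * V * (u * v)) * (u * v) * (g * x / w * s * r) by ring,
    div_mul_eq_mul_div (P * X * Y), mul_div_mul_right _ _ (mul_ne_zero hu hv)]
  ring

lemma j_alg2 (g w P X r s Y R Z V x u v : ℂ) (hu : u ≠ 0) (hv : v ≠ 0) :
    g / w * (P * (s * X) * (Y * r) / (R * Z * V)) * x
    = P * X * Y / (R * (v * Z) * (V * u)) * (g * x / w * (s * v) * (r * u)) := by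
  rw [show R * (v * Z) * (V * u) = (R * Z * V) * (u * v) by ring,
    show P * X * Y / (R * Z * V * (u * v)) * (g * x / w * (s * v) * (r * u))
      = P * X * Y / (R * Z * V * (u * v)) * (u * v) * (g * x / w * s * r) by ring,
    div_mul_eq_mul_div (P * X * Y), mul_div_mul_right _ _ (mul_ne_zero hu hv)]
  ring

lemma j_alg3 (P A B C D E F a b c d e f : ℂ) (ha : a ≠ 0) (hb : b ≠ 0) (hc : c ≠ 0)
    (hd : d ≠ 0) (he : e ≠ 0) (hf : f ≠ 0) :
    P / (A * B * C * D * E * F)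
    = P / ((A * a) * (B * b) * (C * c) * (D * d) * (E * e) * (F * f)) *
      (a * b * c * d * e * f) := by
  rw [show (A * a) * (B * b) * (C * c) * (D * d) * (E * e) * (F * f)
    = (A * B * C * D * E * F) * (a * b * c * d * e * f) by ring, div_mul_eq_mul_div,
    mul_div_mul_right]
  simp [*]

set_option maxHeartbeats 1000000 in
lemma j_step (q a b c d E f : ℂ) (m : ℕ) (ha1 : a ≠ 1)
    (ha : a ≠ 0) (hb : b ≠ 0) (hc : c ≠ 0) (hd : d ≠ 0)
    (hf : f ≠ 0) (hE0 : E ≠ 0) (hq0 : q ≠ 0) (h : E = a ^ 2 / (b * c * d * f))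
    (hq : qPoch q q m ≠ 0) (hB : qPoch (a * q / b) q m ≠ 0)
    (hC : qPoch (a * q / c) q m ≠ 0) (hD : qPoch (a * q / d) q m ≠ 0)
    (hE : qPoch (a / E) q (m + 1) ≠ 0) (hF : qPoch (a / f) q (m + 1) ≠ 0) :
    ∑ k ∈ Finset.range (m + 1),
      (f * ((1 - a / (b * f)) * (1 - a / (c * f)) * (1 - a / (d * f))) * (1 - a / E)
          * jT q a b c d (E * q) f k
        - E * ((1 - a / (b * E)) * (1 - a / (c * E)) * (1 - a / (d * E))) * (1 - a / f)
          * jT q a b c d E (f * q) k)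
    = (f - E) * ((1 - a / f) * (1 - a / E) / (1 - a)) *
      (qPoch a q (m+1) * qPoch b q (m+1) * qPoch c q (m+1) * qPoch d q (m+1)
        * qPoch (E * q) q m * qPoch (f * q) q m /
        (qPoch q q m * qPoch (a * q / b) q m * qPoch (a * q / c) q m * qPoch (a * q / d) q m
          * qPoch (a / E) q (m+1) * qPoch (a / f) q (m+1))) := by
  have ha1' : 1 - a ≠ 0 := sub_ne_zero.2 (Ne.symm ha1)
  have e1 : a * q / (E * q) = a / E := by field_simp
  have e2 : a * q / (f * q) = a / f := by field_simp
  have e3 : a * q / E = a / E * q := by ring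
  have e4 : a * q / f = a / f * q := by ring
  induction m with
  | zero =>
    have hE' : 1 - a / E ≠ 0 := by simpa [qPoch] using hE
    have hF' : 1 - a / f ≠ 0 := by simpa [qPoch] using hF
    simp only [zero_add, Finset.sum_range_one, jT, qPoch_zero', qPoch_succ']
    simp only [mul_one, pow_zero, mul_zero, div_one, one_mul, div_self ha1']
    have : (f - E) * ((1 - a / f) * (1 - a / E) / (1 - a)) *
        ((1 - a) * (1 - b) * (1 - c) * (1 - d) / ((1 - a / E) * (1 - a / f)))
        = (f - E) * (1 - b) * (1 - c) * (1 - d) := by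
      generalize 1 - a / E = u at *
      generalize 1 - a / f = v at *
      generalize 1 - a = w at *
      field_simp
    rw [this]
    exact j_key0 a b c d E f ha hb hc hd hf h
  | succ m ih =>
    have hq' := hq; have hB' := hB; have hC' := hC; have hD' := hD; have hE' := hE; have hF' := hF
    rw [qPoch_succ'] at hq hB hC hD hE hF
    rw [Finset.sum_range_succ, ih (left_ne_zero_of_mul hq) (left_ne_zero_of_mul hB)
      (left_ne_zero_of_mul hC) (left_ne_zero_of_mul hD) (left_ne_zero_of_mul hE)
      (left_ne_zero_of_mul hF)]
    have key := j_key a b c d E f (q ^ (m+1)) ha hb hc hd hf h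
    have hEl : (1 - a / E) * qPoch (a / E * q) q (m+1) = qPoch (a / E) q (m+1) * (1 - a / E * q ^ (m+1)) := by
      rw [← qPoch_succ_left, qPoch_succ']
    have hFl : (1 - a / f) * qPoch (a / f * q) q (m+1) = qPoch (a / f) q (m+1) * (1 - a / f * q ^ (m+1)) := by
      rw [← qPoch_succ_left, qPoch_succ']
    have hEl0 := hEl ▸ hE
    have hFl0 := hFl ▸ hF
    obtain ⟨U, hU⟩ : ∃ U : ℂ, U = qPoch a q (m+1) * qPoch b q (m+1) * qPoch c q (m+1) * qPoch d q (m+1)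
        * qPoch (E * q) q m * qPoch (f * q) q m /
        (qPoch q q (m+1) * qPoch (a * q / b) q (m+1) * qPoch (a * q / c) q (m+1) * qPoch (a * q / d) q (m+1)
          * qPoch (a / E) q (m+2) * qPoch (a / f) q (m+2)) := ⟨_, rfl⟩
    have t1 : jT q a b c d (E * q) f (m+1) = U * ((1 - a * (q ^ (m+1))^2) * q ^ (m+1) / (1 - a)
        * ((1 - f) * (1 - a / f)) * ((1 - E * q ^ (m+1)) * (1 - a / E * q ^ (m+1)))) := by
      rw [hU, jT, e1, e4, qPoch_succ' (E * q), qPoch_succ_left f, qPoch_succ' (a / E) q (m+1),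
        qPoch_succ_left (a / f) q (m+1), pow_mul', show E * q * q ^ m = E * q ^ (m+1) by ring]
      exact j_alg1 _ _ _ _ _ _ _ _ _ _ _ _ _ (right_ne_zero_of_mul hE) (left_ne_zero_of_mul hFl0)
    have t2 : jT q a b c d E (f * q) (m+1) = U * ((1 - a * (q ^ (m+1))^2) * q ^ (m+1) / (1 - a)
        * ((1 - E) * (1 - a / E)) * ((1 - f * q ^ (m+1)) * (1 - a / f * q ^ (m+1)))) := by
      rw [hU, jT, e2, e3, qPoch_succ' (f * q), qPoch_succ_left E, qPoch_succ' (a / f) q (m+1),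
        qPoch_succ_left (a / E) q (m+1), pow_mul', show f * q * q ^ m = f * q ^ (m+1) by ring]
      exact j_alg2 _ _ _ _ _ _ _ _ _ _ _ _ _ (right_ne_zero_of_mul hF) (left_ne_zero_of_mul hEl0)
    have g1 : qPoch a q (m+1+1) * qPoch b q (m+1+1) * qPoch c q (m+1+1) * qPoch d q (m+1+1)
        * qPoch (E * q) q (m+1) * qPoch (f * q) q (m+1) /
        (qPoch q q (m+1) * qPoch (a * q / b) q (m+1) * qPoch (a * q / c) q (m+1) * qPoch (a * q / d) q (m+1)
          * qPoch (a / E) q (m+1+1) * qPoch (a / f) q (m+1+1)) = U * ((1 - a * q ^ (m+1)) *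
           (1 - b * q ^ (m+1)) * (1 - c * q ^ (m+1)) * (1 - d * q ^ (m+1)) * (1 - E * q ^ (m+1))
           * (1 - f * q ^ (m+1))) := by
      rw [hU, qPoch_succ' a q (m+1), qPoch_succ' b q (m+1), qPoch_succ' c q (m+1),
        qPoch_succ' d q (m+1), qPoch_succ' (E*q) q m, qPoch_succ' (f*q) q m,
        show f * q * q ^ m = f * q ^ (m+1) by ring, show E * q * q ^ m = E * q ^ (m+1) by ring]
      ring
    have g0 : qPoch a q (m+1) * qPoch b q (m+1) * qPoch c q (m+1) * qPoch d q (m+1)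
        * qPoch (E * q) q m * qPoch (f * q) q m /
        (qPoch q q m * qPoch (a * q / b) q m * qPoch (a * q / c) q m * qPoch (a * q / d) q m
          * qPoch (a / E) q (m+1) * qPoch (a / f) q (m+1)) = U * ((1 - q ^ (m+1)) *
           (1 - a / b * q ^ (m+1)) * (1 - a / c * q ^ (m+1)) * (1 - a / d * q ^ (m+1))
           * (1 - a / E * q ^ (m+1)) * (1 - a / f * q ^ (m+1))) := by
      rw [hU, qPoch_succ' q, qPoch_succ' (a * q / b), qPoch_succ' (a * q / c),
        qPoch_succ' (a * q / d), qPoch_succ' (a / E) q (m+1), qPoch_succ' (a / f) q (m+1)]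
      rw [show a * q / b * q ^ m = a / b * q ^ (m+1) by ring] at hB ⊢
      rw [show a * q / c * q ^ m = a / c * q ^ (m+1) by ring] at hC ⊢
      rw [show a * q / d * q ^ m = a / d * q ^ (m+1) by ring] at hD ⊢
      rw [show q * q ^ m = q ^ (m+1) by ring] at hq ⊢
      exact j_alg3 _ _ _ _ _ _ _ _ _ _ _ _ _ (right_ne_zero_of_mul hq) (right_ne_zero_of_mul hB)
        (right_ne_zero_of_mul hC) (right_ne_zero_of_mul hD) (right_ne_zero_of_mul hE)
        (right_ne_zero_of_mul hF)
    rw [g1, g0, t1, t2]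
    linear_combination (-U * ((1 - a / f) * (1 - a / E) / (1 - a))) * key

noncomputable def jR (q a b c d : ℂ) (n : ℕ) : ℂ :=
  qPoch (a * q) q n * qPoch (a * q / (b * c)) q n * qPoch (a * q / (b * d)) q n *
        qPoch (a * q / (c * d)) q n /
        (qPoch (a * q / b) q n * qPoch (a * q / c) q n * qPoch (a * q / d) q n *
          qPoch (a * q / (b * c * d)) q n)

lemma j_alg4 (P1 P2 P3 P4 Q1 Q2 Q3 Q4 p1 p2 p3 p4 q1 q2 q3 q4 A B : ℂ)
    (h : A * (p1 * p2 * p3 * p4) = B * (q1 * q2 * q3 * q4)) (h1 : q1 ≠ 0)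
    (h2 : q2 ≠ 0) (h3 : q3 ≠ 0) (h4 : q4 ≠ 0) :
    A * ((P1 * p1) * (P2 * p2) * (P3 * p3) * (P4 * p4) /
      ((Q1 * q1) * (Q2 * q2) * (Q3 * q3) * (Q4 * q4)))
    = B * (P1 * P2 * P3 * P4 / (Q1 * Q2 * Q3 * Q4)) := by
  have hq : q1 * q2 * q3 * q4 ≠ 0 := by simp [*]
  rw [show (Q1 * q1) * (Q2 * q2) * (Q3 * q3) * (Q4 * q4)
    = (Q1 * Q2 * Q3 * Q4) * (q1 * q2 * q3 * q4) by ring, ← mul_div_assoc,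
    show A * ((P1 * p1) * (P2 * p2) * (P3 * p3) * (P4 * p4))
      = (P1 * P2 * P3 * P4) * (A * (p1 * p2 * p3 * p4)) by ring, h,
    show (P1 * P2 * P3 * P4) * (B * (q1 * q2 * q3 * q4))
      = (B * (P1 * P2 * P3 * P4)) * (q1 * q2 * q3 * q4) by ring, mul_div_mul_right _ _ hq,
    mul_div_assoc]

lemma j_fac {a q b : ℂ} {n : ℕ} (hb : b ≠ 0)
    (h : ∀ j : ℕ, 0 < j → j ≤ n → a * q ^ j ≠ b) : qPoch (a * q / b) q n ≠ 0 := by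
  rw [qPoch_ne]
  intro j hj h'
  apply h (j + 1) (by omega) (by omega)
  field_simp at h'
  rw [← h']; ring

lemma j_core (q a b c d : ℂ) (hq0 : q ≠ 0) (hq1 : ∀ m : ℕ, 0 < m → q ^ m ≠ 1) (ha1 : a ≠ 1)
    (ha : a ≠ 0) (hb : b ≠ 0) (hc : c ≠ 0) (hd : d ≠ 0) (n : ℕ) :
    ∀ e : ℂ, e = a ^ 2 * q ^ (n + 1) / (b * c * d) →
    (∀ j : ℕ, 0 < j → j ≤ 2 * n → a * q ^ j ≠ 1) →
    (∀ j : ℕ, 0 < j → j ≤ n → a * q ^ j ≠ b) →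
    (∀ j : ℕ, 0 < j → j ≤ n → a * q ^ j ≠ c) →
    (∀ j : ℕ, 0 < j → j ≤ n → a * q ^ j ≠ d) →
    (∀ j : ℕ, 0 < j → j ≤ n + 1 → a * q ^ j ≠ e) →
    ∑ k ∈ Finset.range (n + 1), jT q a b c d e ((q ^ n)⁻¹) k = jR q a b c d n := by
  induction n with
  | zero =>
    intro e _ _ _ _ _ _
    have : 1 - a ≠ 0 := sub_ne_zero.2 (Ne.symm ha1)
    simp [jT, jR, qPoch_zero', this]
  | succ n ih =>
    intro e he hA hB hC hD hE
    obtain ⟨E, hEdef⟩ : ∃ E : ℂ, E = a ^ 2 * q ^ (n + 1) / (b * c * d) := ⟨_, rfl⟩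
    have heE : e = E * q := by rw [he, hEdef]; ring
    have hqn : q ^ (n + 1) ≠ 0 := pow_ne_zero _ hq0
    have hE0 : E ≠ 0 := by rw [hEdef]; simp [*]
    subst heE
    have IH := ih E hEdef (fun j h1 h2 => hA j h1 (by omega)) (fun j h1 h2 => hB j h1 (by omega))
      (fun j h1 h2 => hC j h1 (by omega)) (fun j h1 h2 => hD j h1 (by omega))
      (fun j h1 h2 h => hE (j + 1) (by omega) (by omega) (by rw [← h]; ring))
    have hfq : (q ^ (n + 1))⁻¹ * q = (q ^ n)⁻¹ := by
      field_simp
      ring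
    have hz : qPoch ((q ^ n)⁻¹) q (n + 1) = 0 := by
      rw [qPoch_succ', inv_mul_cancel₀ (pow_ne_zero _ hq0)]; simp
    have st := j_step q a b c d E ((q ^ (n + 1))⁻¹) (n + 1) ha1 ha hb hc hd (inv_ne_zero hqn) hE0 hq0
      (by rw [hEdef]; field_simp)
      (by
        rw [qPoch_ne]
        intro j _
        rw [← pow_succ']
        exact hq1 _ (by omega))
      (j_fac hb hB) (j_fac hc hC) (j_fac hd hD)
      (by
        have := j_fac (mul_ne_zero hE0 hq0) hE
        rwa [mul_div_mul_right _ _ hq0] at this)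
      (by
        rw [qPoch_ne]
        intro j hj
        rw [div_inv_eq_mul, mul_assoc, ← pow_add]
        exact hA _ (by omega) (by omega))
    rw [hfq, hz, Finset.sum_sub_distrib, ← Finset.mul_sum, ← Finset.mul_sum,
      Finset.sum_range_succ (fun k => jT q a b c d E ((q ^ n)⁻¹) k), IH] at st
    have hlast : jT q a b c d E ((q ^ n)⁻¹) (n + 1) = 0 := by
      rw [jT, hz]; simp
    rw [hlast] at st
    simp only [mul_zero, zero_div, add_zero, zero_mul] at st
    have nz : ∀ z : ℂ, z ≠ 0 → a * q ^ (n + 1) ≠ z → 1 - a * q ^ (n + 1) / z ≠ 0 := by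
      intro z hz h h'
      apply h
      rw [sub_eq_zero] at h'
      field_simp at h'
      exact h'.symm
    have nB := nz b hb (hB _ (by omega) le_rfl)
    have nC := nz c hc (hC _ (by omega) le_rfl)
    have nD := nz d hd (hD _ (by omega) le_rfl)
    have nE : 1 - a / E ≠ 0 := by
      intro h'
      apply hE 1 (by omega) (by omega)
      rw [sub_eq_zero] at h'
      field_simp at h'
      rw [h']; ring
    have nE2 : 1 - a * q ^ (n + 1) / (b * c * d) ≠ 0 := by
      intro h'
      apply nE
      rw [sub_eq_zero] at h'
      have : E = a := by
        rw [hEdef]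
        linear_combination (-a) * h'
      rw [this, div_self ha, sub_self]
    have r : ∀ z : ℂ, a / (z * (q ^ (n + 1))⁻¹) = a * q ^ (n + 1) / z := by
      intro z; rw [← div_div, div_inv_eq_mul]; ring
    rw [r, r, r] at st
    have hfin : ((q ^ (n + 1))⁻¹ * ((1 - a * q ^ (n + 1) / b) * (1 - a * q ^ (n + 1) / c) *
        (1 - a * q ^ (n + 1) / d)) * (1 - a / E)) * jR q a b c d (n + 1)
        = E * ((1 - a / (b * E)) * (1 - a / (c * E)) * (1 - a / (d * E))) *
          (1 - a / (q ^ (n + 1))⁻¹) * jR q a b c d n := by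
      have s : ∀ z : ℂ, a * q / z * q ^ n = a * q ^ (n + 1) / z := by intro z; ring
      rw [jR, jR]
      simp only [qPoch_succ', s]
      apply j_alg4 _ _ _ _ _ _ _ _ _ _ _ _ _ _ _ _ _ _ _ nB nC nD nE2
      rw [show a * q * q ^ n = a * q ^ (n + 1) by ring, hEdef]
      generalize q ^ (n + 1) = y at *
      field_simp
      ring
    refine mul_left_cancel₀ ?_ ((sub_eq_zero.1 st).trans hfin.symm)
    exact mul_ne_zero (mul_ne_zero (inv_ne_zero hqn) (mul_ne_zero (mul_ne_zero nB nC) nD)) nE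

theorem jackson_8W7_summation (n : ℕ) (q a b c d e : ℂ) (hq0 : q ≠ 0)
    (hq1 : ∀ m : ℕ, 0 < m → q ^ m ≠ 1) (ha : a ≠ 1)
    (hb : b ≠ 0) (hc : c ≠ 0) (hd : d ≠ 0) (he : e ≠ 0)
    (hbal : b * c * d * e = a ^ 2 * q ^ (n + 1))
    (hden : ∀ k ≤ n, qPoch q q k ≠ 0 ∧ qPoch (a * q / b) q k ≠ 0 ∧
      qPoch (a * q / c) q k ≠ 0 ∧ qPoch (a * q / d) q k ≠ 0 ∧
      qPoch (a * q / e) q k ≠ 0 ∧ qPoch (a * q ^ (n + 1)) q k ≠ 0) :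
    ∑ k ∈ Finset.range (n + 1), (1 - a * q ^ (2 * k)) / (1 - a) *
        (qPoch a q k * qPoch b q k * qPoch c q k * qPoch d q k * qPoch e q k *
            qPoch (q ^ (-(n : ℤ))) q k /
          (qPoch q q k * qPoch (a * q / b) q k * qPoch (a * q / c) q k *
            qPoch (a * q / d) q k * qPoch (a * q / e) q k *
            qPoch (a * q ^ (n + 1)) q k)) * q ^ k
    = qPoch (a * q) q n * qPoch (a * q / (b * c)) q n * qPoch (a * q / (b * d)) q n *
        qPoch (a * q / (c * d)) q n /
        (qPoch (a * q / b) q n * qPoch (a * q / c) q n * qPoch (a * q / d) q n *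
          qPoch (a * q / (b * c * d)) q n) := by
  have ha0 : a ≠ 0 := by
    rintro rfl
    have : b * c * d * e ≠ 0 := mul_ne_zero (mul_ne_zero (mul_ne_zero hb hc) hd) he
    apply this; rw [hbal]; simp
  have hqn : ∀ j : ℕ, q ^ j ≠ 0 := fun j => pow_ne_zero _ hq0
  have hbcd : b * c * d ≠ 0 := by simp [*]
  have hee : e = a ^ 2 * q ^ (n + 1) / (b * c * d) := by
    rw [← hbal]; field_simp
  have hlast : qPoch (a * q / (b * c * d)) q n ≠ 0 := by
    have := (hden n le_rfl).2.2.2.2.1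
    rw [qPoch_ne] at this ⊢
    intro j hj h
    apply this (n - 1 - j) (by omega)
    have hj' : q ^ (n + 1) = q * q ^ j * q ^ (n - 1 - j) * q := by
      rw [← pow_succ', ← pow_add, ← pow_succ]; congr 1; omega
    rw [hee, hj']
    field_simp at h ⊢
    linear_combination (-1) * h
  set F : ℂ → ℂ := fun x => ∑ k ∈ Finset.range (n + 1),
    jT q x b c d (x ^ 2 * q ^ (n + 1) / (b * c * d)) ((q ^ n)⁻¹) k with hF
  have hfn : ∀ x : ℂ, x * q / (q ^ n)⁻¹ = x * q ^ (n + 1) := by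
    intro x; rw [div_inv_eq_mul]; ring
  have hcF : ContinuousAt F a := by
    rw [hF]
    refine tendsto_finsetSum _ ?_
    intro k hk
    have hk' : k ≤ n := by simpa [Nat.lt_succ_iff] using hk
    obtain ⟨h1, h2, h3, h4, h5, h6⟩ := hden k hk'
    rw [hee] at h5
    have hx : a ^ 2 * q ^ (n + 1) / (b * c * d) ≠ 0 := hee ▸ he
    have hs : 1 - a ≠ 0 := sub_ne_zero.2 (Ne.symm ha)
    change ContinuousAt (fun x => jT q x b c d (x ^ 2 * q ^ (n + 1) / (b * c * d)) ((q ^ n)⁻¹) k) a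
    simp only [jT, hfn]
    simp only [qPoch] at *
    fun_prop (disch := first | assumption | (simp only [mul_ne_zero_iff, ne_eq, not_or] at *; tauto))
  have hcR : ContinuousAt (fun x => jR q x b c d n) a := by
    obtain ⟨h1, h2, h3, h4, h5, h6⟩ := hden n le_rfl
    have : qPoch (a * q / b) q n * qPoch (a * q / c) q n * qPoch (a * q / d) q n *
          qPoch (a * q / (b * c * d)) q n ≠ 0 := by simp [*]
    simp only [jR]
    simp only [qPoch] at *
    fun_prop (disch := assumption)
  have av : ∀ z : ℂ, ∀ᶠ x in nhdsWithin a {a}ᶜ, x ≠ z := by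
    intro z
    by_cases h : a = z
    · subst h; exact eventually_mem_nhdsWithin
    · exact (eventually_ne_nhds h).filter_mono nhdsWithin_le_nhds
  have avj : ∀ (N : ℕ) (z : ℂ), ∀ᶠ x in nhdsWithin a {a}ᶜ,
      ∀ j : ℕ, 0 < j → j ≤ N → x * q ^ j ≠ z := by
    intro N z
    have : ∀ᶠ x in nhdsWithin a {a}ᶜ, ∀ j ∈ Finset.range (N + 1), x ≠ z / q ^ j := by
      rw [Filter.eventually_all_finset]
      intro j _
      exact av _
    filter_upwards [this] with x hx j _ hj h
    apply hx j (by simp; omega)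
    rw [← h]; field_simp [hqn j]
  have avE : ∀ᶠ x in nhdsWithin a {a}ᶜ,
      ∀ j : ℕ, 0 < j → j ≤ n + 1 → x * q ^ j ≠ x ^ 2 * q ^ (n + 1) / (b * c * d) := by
    have : ∀ᶠ x in nhdsWithin a {a}ᶜ, ∀ j ∈ Finset.range (n + 2),
        x ≠ b * c * d * q ^ j / q ^ (n + 1) := by
      rw [Filter.eventually_all_finset]
      intro j _
      exact av _
    filter_upwards [this, av 0] with x hx hx0 j _ hj h
    apply hx j (by simp; omega)
    have h1 := hqn (n + 1)
    rw [eq_div_iff hbcd] at h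
    rw [eq_div_iff h1]
    apply mul_left_cancel₀ hx0
    linear_combination -h
  have hev : F =ᶠ[nhdsWithin a {a}ᶜ] (fun x => jR q x b c d n) := by
    filter_upwards [av 0, av 1, avj (2 * n) 1, avj n b, avj n c, avj n d, avE] with
      x h0 h1 h2 h3 h4 h5 h6
    exact j_core q x b c d hq0 hq1 h1 h0 hb hc hd n _ rfl h2 h3 h4 h5 h6
  have hfinal : F a = jR q a b c d n :=
    tendsto_nhds_unique ((hcF.tendsto.mono_left nhdsWithin_le_nhds).congr' hev)
      (hcR.tendsto.mono_left nhdsWithin_le_nhds)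
  simp only [hF, ← hee, jT, jR, hfn] at hfinal
  rw [zpow_neg, zpow_natCast]
  exact hfinal
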